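/- Let d ≥ 1 and m ≥ 1 be integers, set n = d + m and c = 4*(n+1). Let X, N be d×m quaternionic matrices satisfying Re (trace (X * Nᴴ)) = 0 and Re (trace (X * Xᴴ)) = Re (trace (N * Nᴴ)) = 1/(2*c). Then -2/(n+1) - 8*c * Re (trace (X * Nᴴ * X * Nᴴ + N * Nᴴ * N * Nᴴ)) ≤ -3/(2*(n+1)). -/

import Mathlib

open Matrix Quaternion

theorem quaternion_re_sum {α : Type*} (s : Finset α) (f : α → ℍ[ℝ]) :
    (∑ a ∈ s, f a).re = ∑ a ∈ s, (f a).re :=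
  map_sum (QuaternionAlgebra.reₗ (-1 : ℝ) 0 (-1)) f s

/-- The squared Frobenius norm of a quaternionic matrix is `Re (trace (A * Aᴴ))`. -/
theorem re_trace_mul_conjTranspose_self {ι κ : Type*} [Fintype ι] [Fintype κ]
    (A : Matrix ι κ ℍ[ℝ]) :
    (Matrix.trace (A * Aᴴ)).re = ∑ i, ∑ j, ‖A i j‖ ^ 2 := by
  simp only [Matrix.trace, Matrix.diag, Matrix.mul_apply, Matrix.conjTranspose_apply, quaternion_re_sum,
    ← Quaternion.inner_def, real_inner_self_eq_norm_sq]

/-- For a square quaternionic matrix, `Re (trace (A * A))` is at least minus the squared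
Frobenius norm. -/
theorem neg_sum_norm_sq_le_re_trace_mul_self {ι : Type*} [Fintype ι] (A : Matrix ι ι ℍ[ℝ]) :
    -∑ i, ∑ j, ‖A i j‖ ^ 2 ≤ (Matrix.trace (A * A)).re := by
  have entry (a b : ℍ[ℝ]) : -(‖a‖ ^ 2 + ‖b‖ ^ 2) / 2 ≤ (a * b).re := by
    have h := neg_le_of_abs_le (abs_real_inner_le_norm a (star b))
    rw [Quaternion.inner_def, star_star, norm_star] at h
    nlinarith [sq_nonneg (‖a‖ - ‖b‖)]
  have swap : ∑ i, ∑ j, ‖A j i‖ ^ 2 = ∑ i, ∑ j, ‖A i j‖ ^ 2 := Finset.sum_comm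
  calc -∑ i, ∑ j, ‖A i j‖ ^ 2
      = ∑ i, ∑ j, -(‖A i j‖ ^ 2 + ‖A j i‖ ^ 2) / 2 := by
        simp only [← Finset.sum_div, Finset.sum_neg_distrib, Finset.sum_add_distrib, swap]
        ring
    _ ≤ ∑ i, ∑ j, (A i j * A j i).re :=
        Finset.sum_le_sum fun i _ => Finset.sum_le_sum fun j _ => entry _ _
    _ = (Matrix.trace (A * A)).re := by
        simp only [Matrix.trace, Matrix.diag, Matrix.mul_apply, quaternion_re_sum]

/-- Submultiplicativity of the Frobenius norm over the quaternions. -/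
theorem sum_norm_sq_mul_conjTranspose_le {ι κ l : Type*} [Fintype ι] [Fintype κ] [Fintype l]
    (X : Matrix ι κ ℍ[ℝ]) (N : Matrix l κ ℍ[ℝ]) :
    ∑ i, ∑ j, ‖(X * Nᴴ) i j‖ ^ 2 ≤
      (∑ i, ∑ k, ‖X i k‖ ^ 2) * ∑ j, ∑ k, ‖N j k‖ ^ 2 := by
  rw [Finset.sum_mul_sum]
  refine Finset.sum_le_sum fun i _ => Finset.sum_le_sum fun j _ => ?_
  calc ‖(X * Nᴴ) i j‖ ^ 2 ≤ (∑ k, ‖X i k‖ * ‖N j k‖) ^ 2 := by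
        gcongr
        rw [Matrix.mul_apply]
        refine (norm_sum_le _ _).trans_eq ?_
        simp only [norm_mul, Matrix.conjTranspose_apply, norm_star]
    _ ≤ _ := Finset.sum_mul_sq_le_sq_mul_sq _ _ _

theorem stmt_11 (d m : ℕ) (hd : 1 ≤ d) (hm : 1 ≤ m)
    (X N : Matrix (Fin d) (Fin m) ℍ[ℝ])
    (hXN : (Matrix.trace (X * Nᴴ)).re = 0)
    (hX : (Matrix.trace (X * Xᴴ)).re = 1 / (2 * (4 * ((d : ℝ) + m + 1))))
    (hN : (Matrix.trace (N * Nᴴ)).re = 1 / (2 * (4 * ((d : ℝ) + m + 1)))) :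
    -2 / ((d : ℝ) + m + 1) -
        8 * (4 * ((d : ℝ) + m + 1)) *
          (Matrix.trace (X * Nᴴ * X * Nᴴ + N * Nᴴ * N * Nᴴ)).re ≤
      -3 / (2 * ((d : ℝ) + m + 1)) := by
  have hXX := neg_sum_norm_sq_le_re_trace_mul_self (X * Nᴴ)
  have hmul := sum_norm_sq_mul_conjTranspose_le X N
  rw [← re_trace_mul_conjTranspose_self, ← re_trace_mul_conjTranspose_self X,
    ← re_trace_mul_conjTranspose_self N, hX, hN] at hmul
  rw [← re_trace_mul_conjTranspose_self] at hXX
  have hNN : 0 ≤ (Matrix.trace (N * Nᴴ * (N * Nᴴ))).re := by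
    have hherm : (N * Nᴴ)ᴴ = N * Nᴴ := by
      rw [Matrix.conjTranspose_mul, Matrix.conjTranspose_conjTranspose]
    have h := re_trace_mul_conjTranspose_self (N * Nᴴ)
    rw [hherm] at h
    rw [h]
    positivity
  rw [Matrix.mul_assoc (X * Nᴴ), Matrix.mul_assoc (N * Nᴴ), Matrix.trace_add,
    Quaternion.re_add]
  set t : ℝ := (d : ℝ) + m + 1
  have ht : 0 < t := by positivity
  set T := (Matrix.trace (X * Nᴴ * (X * Nᴴ))).re + (Matrix.trace (N * Nᴴ * (N * Nᴴ))).re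
  have hT : -(1 / (2 * (4 * t)) * (1 / (2 * (4 * t)))) ≤ T := by linarith
  calc -2 / t - 8 * (4 * t) * T
      ≤ -2 / t - 8 * (4 * t) * -(1 / (2 * (4 * t)) * (1 / (2 * (4 * t)))) := by gcongr
    _ = -3 / (2 * t) := by
        field_simp
        norm_num
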